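/- Let u = √3/2, let f₁ = z, f₂ = x²+y², f₃ = 11x⁶+15x⁴y²+45x²y⁴+9y⁶, let Γ be the degree-12 homogeneous polynomial Γ = (2093688/17)f₁¹² − (9398511/34)f₁¹⁰f₂ + (2995218/17)f₁⁸f₂² − (64485153/1088)f₁⁶f₂³ + (18708003/4352)f₁⁴f₂⁴ + (1258659/4352)f₁²f₂⁵ − (493695/4352)f₂⁶ + (2121309/1088)f₁⁶f₃ − (402561/4352)f₁⁴f₂f₃ − (158697/4352)f₁²f₂²f₃ + (2619/128)f₂³f₃ − (3979/4352)f₃², and let G be the dihedral group of order 12 generated by A = [[1/2, −u, 0],[u, 1/2, 0],[0, 0, 1]] and B = [[−1,0,0],[0,1,0],[0,0,1]] acting on ℙ²(ℝ). Then the set of singular points of the plane curve {Γ = 0} in ℙ²(ℝ) (points where Γ and all its first-order partial derivatives vanish) is exactly the G-orbit of the point (9 : 2u : 4u), which consists of 12 points, and each of these 12 points is an ordinary double point of the curve. -/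

import Mathlib

open MvPolynomial

noncomputable section

/-- The polynomial ring `ℝ[x,y,z]`, with `x = X 0`, `y = X 1`, `z = X 2`. -/
abbrev PolyR := MvPolynomial (Fin 3) ℝ

/-- `u = √3 / 2`. -/
def u : ℝ := Real.sqrt 3 / 2

/-- The rotation by 60° about `(0:0:1)`. -/
def rotA : Matrix (Fin 3) (Fin 3) ℝ := !![1/2, -u, 0; u, 1/2, 0; 0, 0, 1]

/-- The reflection `B`. -/
def matB : Matrix (Fin 3) (Fin 3) ℝ := !![-1, 0, 0; 0, 1, 0; 0, 0, 1]

/-- The rotation `A` as an element of `GL₃(ℝ)`. -/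
def glA : Matrix.GeneralLinearGroup (Fin 3) ℝ :=
  Matrix.GeneralLinearGroup.mkOfDetNeZero rotA (by
    have h3 : Real.sqrt 3 * Real.sqrt 3 = 3 := Real.mul_self_sqrt (by norm_num)
    simp [rotA, u, Matrix.det_fin_three]
    nlinarith [Real.sqrt_nonneg 3])

/-- The reflection `B` as an element of `GL₃(ℝ)`. -/
def glB : Matrix.GeneralLinearGroup (Fin 3) ℝ :=
  Matrix.GeneralLinearGroup.mkOfDetNeZero matB (by
    simp [matB, Matrix.det_fin_three])

/-- The subgroup `G ⊆ GL₃(ℝ)` generated by `A` and `B`; it is dihedral of order 12. -/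
def Ggrp : Subgroup (Matrix.GeneralLinearGroup (Fin 3) ℝ) := Subgroup.closure {glA, glB}

/-- Linear substitution of variables by a matrix `M`:  `(substMat M f)(v) = f(M v)`. -/
def substMat (M : Matrix (Fin 3) (Fin 3) ℝ) : PolyR →ₐ[ℝ] PolyR :=
  MvPolynomial.aeval fun i => ∑ j, MvPolynomial.C (M i j) * MvPolynomial.X j

/-- The real projective plane `ℙ²(ℝ)`. -/
abbrev P2R := Projectivization ℝ (Fin 3 → ℝ)

/-- The `G`-orbit in `ℙ²(ℝ)` of the point with homogeneous coordinates `v`: the set of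
points `Q` whose representative is proportional to `M·v` for some `M ∈ G`. -/
def orbitOf (v : Fin 3 → ℝ) : Set P2R :=
  {Q | ∃ M ∈ Ggrp, ∃ c : ℝ, c ≠ 0 ∧
    (M : Matrix (Fin 3) (Fin 3) ℝ).mulVec v = c • Projectivization.rep Q}

/-- The invariant `f₁ = z`. -/
def f1 : PolyR := X 2

/-- The invariant `f₂ = x² + y²`. -/
def f2 : PolyR := X 0 ^ 2 + X 1 ^ 2

/-- The invariant `f₃ = 11x⁶ + 15x⁴y² + 45x²y⁴ + 9y⁶`. -/
def f3 : PolyR :=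
  C 11 * X 0 ^ 6 + C 15 * X 0 ^ 4 * X 1 ^ 2 + C 45 * X 0 ^ 2 * X 1 ^ 4 + C 9 * X 1 ^ 6

/-- The degree-12 curve `Γ`, expressed in terms of the invariants `f₁`, `f₂`, `f₃`. -/
def Γpoly : PolyR :=
  C (2093688/17) * f1 ^ 12 - C (9398511/34) * f1 ^ 10 * f2 + C (2995218/17) * f1 ^ 8 * f2 ^ 2
    - C (64485153/1088) * f1 ^ 6 * f2 ^ 3 + C (18708003/4352) * f1 ^ 4 * f2 ^ 4
    + C (1258659/4352) * f1 ^ 2 * f2 ^ 5 - C (493695/4352) * f2 ^ 6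
    + C (2121309/1088) * f1 ^ 6 * f3 - C (402561/4352) * f1 ^ 4 * f2 * f3
    - C (158697/4352) * f1 ^ 2 * f2 ^ 2 * f3 + C (2619/128) * f2 ^ 3 * f3
    - C (3979/4352) * f3 ^ 2

end

noncomputable section

lemma cert9 (Z s : ℝ) (h1 : (-14580)*Z^0*s^6 + (-169614)*Z^1*s^5 + (15084954)*Z^2*s^4 + (-181573488)*Z^3*s^3 + (766775808)*Z^4*s^2 + (-1203009408)*Z^5*s^1 + (535984128)*Z^6*s^0 = 0) (h2 : (-169614)*Z^0*s^5 + (30169908)*Z^1*s^4 + (-544720464)*Z^2*s^3 + (3067103232)*Z^3*s^2 + (-6015047040)*Z^4*s^1 + (3215904768)*Z^5*s^0 = 0) : s = 0 := by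
  have : (290870494439303070761493303241249218750 : ℝ) * s^10 = 0 := by
    linear_combination ((-38919936281278587940589457635046596)*Z^0*s^4 + (3274181591704258295326964990594112176)*Z^1*s^3 + (-26286848665160880051385755721479983680)*Z^2*s^2 + (59230340741971062057654734454260042368)*Z^3*s^1 + (-33346738925143781806057403637880860672)*Z^4*s^0) * h1 + ((1630656529188267132502629435528495)*Z^0*s^5 + (47522939914004943790702008869758766)*Z^1*s^4 + (-1259798646056954883943902903831123600)*Z^2*s^3 + (6835586942122298249691806381366375232)*Z^3*s^2 + (-11950787958129671697968122139039081600)*Z^4*s^1 + (5557789820857296967676233939646810112)*Z^5*s^0) * h2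
  simpa using this

lemma cert11 (Z s : ℝ) (h1 : (4352)*Z^0*s^6 + (-487008)*Z^1*s^5 + (14279832)*Z^2*s^4 + (-164603016)*Z^3*s^3 + (766775808)*Z^4*s^2 + (-1203009408)*Z^5*s^1 + (535984128)*Z^6*s^0 = 0) (h2 : (-487008)*Z^0*s^5 + (28559664)*Z^1*s^4 + (-493809048)*Z^2*s^3 + (3067103232)*Z^3*s^2 + (-6015047040)*Z^4*s^1 + (3215904768)*Z^5*s^0 = 0) : s = 0 := by
  have : (30621818731517203451034320045309160000 : ℝ) * s^10 = 0 := by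
    linear_combination ((-333609837231887855339233534376092632)*Z^0*s^4 + (13780713736520069607450279657004036527)*Z^1*s^3 + (-119241958333029553399068932896432402848)*Z^2*s^2 + (259587622716679894645699116627372661872)*Z^3*s^1 + (-144243360081168416584313055339244478976)*Z^4*s^0) * h1 + ((-3044081063072255794334751506443558)*Z^0*s^5 + (278242643738616512205999604994562381)*Z^1*s^4 + (-5224637130893300090335839931437349221)*Z^2*s^3 + (30701443274703446086216666057977152352)*Z^3*s^2 + (-52257724527014208893401809146570451888)*Z^4*s^1 + (24040560013528069430718842556540746496)*Z^5*s^0) * h2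
  simpa using this

lemma certD (Z s : ℝ) (hs : s ≠ 0) (h1 : (71540496)*Z^0*s^6 + (-8229849480)*Z^1*s^5 + (251248419945)*Z^2*s^4 + (-2466459684846)*Z^3*s^3 + (9672896123865)*Z^4*s^2 + (-25978747916520)*Z^5*s^1 + (80529953356944)*Z^6*s^0 = 0) (h2 : (-8229849480)*Z^0*s^5 + (502496839890)*Z^1*s^4 + (-7399379054538)*Z^2*s^3 + (38691584495460)*Z^3*s^2 + (-129893739582600)*Z^4*s^1 + (483179720141664)*Z^5*s^0 = 0) : s = 7 * Z := by
  have : ((381777282909181114449988107904722906633604096290032081909760) * Z + (-54539611844168730635712586843531843804800585184290297415680) * s) * s^9 = 0 := by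
    linear_combination ((5142693642811180563218051162330138176681013051105930)*Z^0*s^4 + (-63404454738084306456602741246876067459974332711944500)*Z^1*s^3 + (105092003176941656050636968663003872984127300573886296)*Z^2*s^2 + (-1064230659276068776669542570195650375031170622260027808)*Z^3*s^1) * h1 + ((51331493589713553603642739180450532943780630680852)*Z^0*s^5 + (-2606055525319927198525742435068459747117988049007381)*Z^1*s^4 + (16047105195575046114157459273621866838184341727435015)*Z^2*s^3 + (-27051944110131074846517355147088924340555974481048456)*Z^3*s^2 + (177371776546011462778257095032608395838528437043337968)*Z^4*s^1) * h2
  rcases mul_eq_zero.1 this with h | h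
  · linarith
  · exact absurd (by simpa using h) hs


/-- the polynomial 4352 Γ in the invariants -/
def gA (Z s : ℝ) : ℝ := 535984128*Z^6 - 1203009408*Z^5*s + 766775808*Z^4*s^2 - 257940612*Z^3*s^3
  + 18708003*Z^2*s^4 + 1258659*Z*s^5 - 493695*s^6
def gB (Z s : ℝ) : ℝ := 8485236*Z^3 - 402561*Z^2*s - 158697*Z*s^2 + 89046*s^3
def gAZ (Z s : ℝ) : ℝ := 6*535984128*Z^5 - 5*1203009408*Z^4*s + 4*766775808*Z^3*s^2
  - 3*257940612*Z^2*s^3 + 2*18708003*Z*s^4 + 1258659*s^5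
def gBZ (Z s : ℝ) : ℝ := 3*8485236*Z^2 - 2*402561*Z*s - 158697*s^2
def gAs (Z s : ℝ) : ℝ := - 1203009408*Z^5 + 2*766775808*Z^4*s - 3*257940612*Z^3*s^2
  + 4*18708003*Z^2*s^3 + 5*1258659*Z*s^4 - 6*493695*s^5
def gBs (Z s : ℝ) : ℝ := - 402561*Z^2 - 2*158697*Z*s + 3*89046*s^2
def gAss (Z s : ℝ) : ℝ := 2*766775808*Z^4 - 6*257940612*Z^3*s
  + 12*18708003*Z^2*s^2 + 20*1258659*Z*s^3 - 30*493695*s^4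
def gBss (Z s : ℝ) : ℝ := - 2*158697*Z + 6*89046*s

def sF (v : Fin 3 → ℝ) : ℝ := v 0 ^ 2 + v 1 ^ 2
def tF (v : Fin 3 → ℝ) : ℝ := 11 * v 0 ^ 6 + 15 * v 0 ^ 4 * v 1 ^ 2 + 45 * v 0 ^ 2 * v 1 ^ 4 + 9 * v 1 ^ 6
def imF (v : Fin 3 → ℝ) : ℝ := 6 * v 0 ^ 5 * v 1 - 20 * v 0 ^ 3 * v 1 ^ 3 + 6 * v 0 * v 1 ^ 5
def tx (v : Fin 3 → ℝ) : ℝ := 66 * v 0 ^ 5 + 60 * v 0 ^ 3 * v 1 ^ 2 + 90 * v 0 * v 1 ^ 4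
def ty (v : Fin 3 → ℝ) : ℝ := 30 * v 0 ^ 4 * v 1 + 180 * v 0 ^ 2 * v 1 ^ 3 + 54 * v 1 ^ 5

lemma jac_eq (v : Fin 3 → ℝ) : 2 * v 0 * ty v - 2 * v 1 * tx v = - 12 * imF v := by
  simp only [tx, ty, imF]; ring

lemma im_sq (v : Fin 3 → ℝ) : imF v ^ 2 = - ((tF v - 9 * sF v ^ 3) * (tF v - 11 * sF v ^ 3)) := by
  simp only [tF, sF, imF]; ring

lemma eval_f1 (v : Fin 3 → ℝ) : eval v f1 = v 2 := by simp [f1]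
lemma eval_f2 (v : Fin 3 → ℝ) : eval v f2 = sF v := by simp [f2, sF]
lemma eval_f3 (v : Fin 3 → ℝ) : eval v f3 = tF v := by simp [f3, tF]

lemma eval_G (v : Fin 3 → ℝ) : 4352 * eval v Γpoly =
    gA (v 2 ^ 2) (sF v) + gB (v 2 ^ 2) (sF v) * tF v - 3979 * tF v ^ 2 := by
  simp only [Γpoly, map_add, map_sub, map_mul, map_pow, eval_C, eval_f1, eval_f2, eval_f3, gA, gB]
  ring

def Pz : PolyR := C (12 * 2093688/17) * f1 ^ 11 - C (10 * 9398511/34) * f1 ^ 9 * f2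
    + C (8 * 2995218/17) * f1 ^ 7 * f2 ^ 2
    - C (6 * 64485153/1088) * f1 ^ 5 * f2 ^ 3 + C (4 * 18708003/4352) * f1 ^ 3 * f2 ^ 4
    + C (2 * 1258659/4352) * f1 * f2 ^ 5
    + C (6 * 2121309/1088) * f1 ^ 5 * f3 - C (4 * 402561/4352) * f1 ^ 3 * f2 * f3
    - C (2 * 158697/4352) * f1 * f2 ^ 2 * f3
def Ps : PolyR := - C (9398511/34) * f1 ^ 10 + C (2 * 2995218/17) * f1 ^ 8 * f2
    - C (3 * 64485153/1088) * f1 ^ 6 * f2 ^ 2 + C (4 * 18708003/4352) * f1 ^ 4 * f2 ^ 3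
    + C (5 * 1258659/4352) * f1 ^ 2 * f2 ^ 4 - C (6 * 493695/4352) * f2 ^ 5
    - C (402561/4352) * f1 ^ 4 * f3
    - C (2 * 158697/4352) * f1 ^ 2 * f2 * f3 + C (3 * 2619/128) * f2 ^ 2 * f3
def Pt : PolyR :=
    C (2121309/1088) * f1 ^ 6 - C (402561/4352) * f1 ^ 4 * f2
    - C (158697/4352) * f1 ^ 2 * f2 ^ 2 + C (2619/128) * f2 ^ 3
    - C (2 * 3979/4352) * f3
def Pss : PolyR := C (2 * 2995218/17) * f1 ^ 8
    - C (6 * 64485153/1088) * f1 ^ 6 * f2 + C (12 * 18708003/4352) * f1 ^ 4 * f2 ^ 2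
    + C (20 * 1258659/4352) * f1 ^ 2 * f2 ^ 3 - C (30 * 493695/4352) * f2 ^ 4
    - C (2 * 158697/4352) * f1 ^ 2 * f3 + C (6 * 2619/128) * f2 * f3
def Pst : PolyR := - C (402561/4352) * f1 ^ 4
    - C (2 * 158697/4352) * f1 ^ 2 * f2 + C (3 * 2619/128) * f2 ^ 2

lemma pd_G (i : Fin 3) : pderiv i Γpoly = Pz * pderiv i f1 + Ps * pderiv i f2 + Pt * pderiv i f3 := by
  simp only [Γpoly, Pz, Ps, Pt, map_add, map_sub, Derivation.leibniz, Derivation.leibniz_pow,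
    pderiv_C, smul_eq_mul, nsmul_eq_mul, mul_div_assoc, C_mul]
  simp only [map_ofNat]
  push_cast
  ring

lemma pd_s (i : Fin 3) (h : pderiv i f1 = 0) : pderiv i Ps = Pss * pderiv i f2 + Pst * pderiv i f3 := by
  simp only [Pss, Pst, Ps, map_add, map_sub, map_neg, Derivation.leibniz, Derivation.leibniz_pow,
    pderiv_C, smul_eq_mul, nsmul_eq_mul, mul_div_assoc, C_mul, h]
  rw [show (12 : ℝ) = 4 * 3 by norm_num, show (20 : ℝ) = 5 * 4 by norm_num,
    show (30 : ℝ) = 6 * 5 by norm_num, show (6 : ℝ) = 3 * 2 by norm_num]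
  simp only [map_ofNat, C_mul]
  push_cast
  ring

lemma pd_t (i : Fin 3) (h : pderiv i f1 = 0) :
    pderiv i Pt = Pst * pderiv i f2 - C (2 * 3979/4352) * pderiv i f3 := by
  simp only [Pst, Pt, map_add, map_sub, map_neg, Derivation.leibniz, Derivation.leibniz_pow,
    pderiv_C, smul_eq_mul, nsmul_eq_mul, mul_div_assoc, C_mul, h]
  simp only [map_ofNat, C_mul]
  push_cast
  ring

lemma f1_0 : pderiv 0 f1 = 0 := by simp [f1, pderiv_X]
lemma f1_1 : pderiv 1 f1 = 0 := by simp [f1, pderiv_X]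
lemma f1_2 : pderiv 2 f1 = 1 := by simp [f1]
lemma f2_0 : pderiv 0 f2 = C 2 * X 0 := by
  simp [f2, pderiv_X, Derivation.leibniz_pow, map_ofNat]
lemma f2_1 : pderiv 1 f2 = C 2 * X 1 := by
  simp [f2, pderiv_X, Derivation.leibniz_pow, map_ofNat]
lemma f2_2 : pderiv 2 f2 = 0 := by
  simp [f2, pderiv_X, Derivation.leibniz_pow]
lemma f3_0 : pderiv 0 f3 = C 66 * X 0 ^ 5 + C 60 * X 0 ^ 3 * X 1 ^ 2 + C 90 * X 0 * X 1 ^ 4 := by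
  simp [f3, pderiv_X, Derivation.leibniz_pow, Derivation.leibniz]
  simp only [map_ofNat]
  ring
lemma f3_1 : pderiv 1 f3 = C 30 * X 0 ^ 4 * X 1 + C 180 * X 0 ^ 2 * X 1 ^ 3 + C 54 * X 1 ^ 5 := by
  simp [f3, pderiv_X, Derivation.leibniz_pow, Derivation.leibniz]
  simp only [map_ofNat]
  ring
lemma f3_2 : pderiv 2 f3 = 0 := by
  simp [f3, pderiv_X, Derivation.leibniz_pow, Derivation.leibniz]

lemma ev_f2_0 (v : Fin 3 → ℝ) : eval v (pderiv 0 f2) = 2 * v 0 := by simp [f2_0]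
lemma ev_f2_1 (v : Fin 3 → ℝ) : eval v (pderiv 1 f2) = 2 * v 1 := by simp [f2_1]
lemma ev_f3_0 (v : Fin 3 → ℝ) : eval v (pderiv 0 f3) = tx v := by simp [f3_0, tx]
lemma ev_f3_1 (v : Fin 3 → ℝ) : eval v (pderiv 1 f3) = ty v := by simp [f3_1, ty]

lemma ev_Pz (v : Fin 3 → ℝ) : 4352 * eval v Pz =
    2 * v 2 * (gAZ (v 2 ^ 2) (sF v) + gBZ (v 2 ^ 2) (sF v) * tF v) := by
  simp only [Pz, map_add, map_sub, map_mul, map_pow, eval_C, eval_f1, eval_f2, eval_f3, gAZ, gBZ]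
  ring
lemma ev_Ps (v : Fin 3 → ℝ) : 4352 * eval v Ps =
    gAs (v 2 ^ 2) (sF v) + gBs (v 2 ^ 2) (sF v) * tF v := by
  simp only [Ps, map_add, map_sub, map_neg, map_mul, map_pow, eval_C, eval_f1, eval_f2, eval_f3, gAs, gBs]
  ring
lemma ev_Pt (v : Fin 3 → ℝ) : 4352 * eval v Pt =
    gB (v 2 ^ 2) (sF v) - 7958 * tF v := by
  simp only [Pt, map_add, map_sub, map_neg, map_mul, map_pow, eval_C, eval_f1, eval_f2, eval_f3, gB]
  ring
lemma ev_Pss (v : Fin 3 → ℝ) : 4352 * eval v Pss =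
    gAss (v 2 ^ 2) (sF v) + gBss (v 2 ^ 2) (sF v) * tF v := by
  simp only [Pss, map_add, map_sub, map_neg, map_mul, map_pow, eval_C, eval_f1, eval_f2, eval_f3, gAss, gBss]
  ring
lemma ev_Pst (v : Fin 3 → ℝ) : 4352 * eval v Pst = gBs (v 2 ^ 2) (sF v) := by
  simp only [Pst, map_add, map_sub, map_neg, map_mul, map_pow, eval_C, eval_f1, eval_f2, eval_f3, gBs]
  ring

/-- the invariant description of the orbit -/
def InS (v : Fin 3 → ℝ) : Prop := sF v = 7 * v 2 ^ 2 ∧ tF v = 3573 * (v 2 ^ 2) ^ 3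

lemma sF_eq_zero {v : Fin 3 → ℝ} (h : sF v = 0) : v 0 = 0 ∧ v 1 = 0 := by
  unfold sF at h
  constructor <;> nlinarith [sq_nonneg (v 0), sq_nonneg (v 1)]

lemma sing_imp (v : Fin 3 → ℝ) (hv : v ≠ 0) (h : eval v Γpoly = 0)
    (hd : ∀ i, eval v (pderiv i Γpoly) = 0) : InS v := by
  have hG := eval_G v
  rw [h, mul_zero] at hG
  have hs : sF v ≠ 0 := by
    intro hs
    obtain ⟨h0, h1⟩ := sF_eq_zero hs
    have ht : tF v = 0 := by simp [tF, h0, h1]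
    rw [hs, ht] at hG
    have h2 : v 2 = 0 := by simpa [gA, gB] using hG
    apply hv; ext i; fin_cases i <;> simp [h0, h1, h2]
  have d0 := hd 0
  have d1 := hd 1
  have d2 := hd 2
  rw [pd_G] at d0 d1 d2
  simp only [f1_0, f1_1, f1_2, f2_2, f3_2, map_add, map_mul, ev_f2_0, ev_f2_1, ev_f3_0, ev_f3_1,
    map_zero, map_one, mul_zero, mul_one, zero_add, add_zero] at d0 d1 d2
  have hz := ev_Pz v
  rw [d2, mul_zero] at hz
  have hjt : eval v Pt * imF v = 0 := by
    have := jac_eq v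
    linear_combination (-1/12) * (2 * v 0 * d1 - 2 * v 1 * d0) + (1/12) * eval v Pt * this
  have ht := ev_Pt v
  have him := im_sq v
  clear d0 d1 d2 hd
  unfold InS
  generalize sF v = s at *
  generalize tF v = t at *
  rcases mul_eq_zero.1 hjt with h0 | h0
  · rw [h0, mul_zero] at ht
    have hz0 : v 2 ≠ 0 := by
      intro h2
      rw [h2] at hG ht
      apply hs
      have : (71540496 : ℝ) * s ^ 6 = 0 := by
        simp only [gA, gB] at hG ht
        linear_combination (-15916) * hG - (89046 * s^3 - 7958 * t) * ht
      simpa using this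
    have hz' : gAZ (v 2 ^ 2) s + gBZ (v 2 ^ 2) s * t = 0 := by
      rcases mul_eq_zero.1 hz.symm with h | h
      · simp [hz0] at h
      · exact h
    have key : s = 7 * v 2 ^ 2 := by
      generalize v 2 ^ 2 = Z at *
      apply certD Z s hs
      · simp only [gA, gB] at hG ht
        linear_combination (-15916) * hG - ((8485236*(Z)^3 - 402561*(Z)^2*s - 158697*(Z)*s^2 + 89046*s^3) - 7958 * t) * ht
      · simp only [gAZ, gB, gBZ] at hz' ht
        linear_combination 15916 * hz' - 2 * (3*8485236*Z^2 - 2*402561*Z*s - 158697*s^2) * ht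
    refine ⟨key, ?_⟩
    rw [key] at ht
    simp only [gB] at ht
    linear_combination (1/7958) * ht
  · exfalso
    rw [h0] at him
    have ht' : (t - 9 * s ^ 3) * (t - 11 * s ^ 3) = 0 := by linarith
    have hz' : t = 9 * s ^ 3 ∨ t = 11 * s ^ 3 := by
      rcases mul_eq_zero.1 ht' with h | h
      · left; linarith
      · right; linarith
    have hv2 : v 2 ≠ 0 := by
      intro h2
      rw [h2] at hG
      rcases hz' with h | h
      · rw [h] at hG
        simp only [gA, gB] at hG
        apply hs
        have : (14580 : ℝ) * s ^ 6 = 0 := by linear_combination hG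
        simpa using this
      · rw [h] at hG
        simp only [gA, gB] at hG
        apply hs
        have : (4352 : ℝ) * s ^ 6 = 0 := by linear_combination - hG
        simpa using this
    have hz'' : gAZ (v 2 ^ 2) s + gBZ (v 2 ^ 2) s * t = 0 := by
      rcases mul_eq_zero.1 hz.symm with h | h
      · simp [hv2] at h
      · exact h
    simp only [gA, gB, gAZ, gBZ] at hG hz''
    apply hs
    rcases hz' with h | h
    · subst h
      apply cert9 (v 2 ^ 2) s
      · linear_combination - hG
      · linear_combination hz''
    · subst h
      apply cert11 (v 2 ^ 2) s
      · linear_combination - hG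
      · linear_combination hz''

lemma inS_Ps {v : Fin 3 → ℝ} (h : InS v) : eval v Ps = 0 := by
  have := ev_Ps v
  rw [h.1, h.2] at this
  simp only [gAs, gBs] at this
  linear_combination (1/4352) * this
lemma inS_Pt {v : Fin 3 → ℝ} (h : InS v) : eval v Pt = 0 := by
  have := ev_Pt v
  rw [h.1, h.2] at this
  simp only [gB] at this
  linear_combination (1/4352) * this
lemma inS_Pz {v : Fin 3 → ℝ} (h : InS v) : eval v Pz = 0 := by
  have := ev_Pz v
  rw [h.1, h.2] at this
  simp only [gAZ, gBZ] at this
  linear_combination (1/4352) * this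

lemma inS_sing {v : Fin 3 → ℝ} (h : InS v) : eval v Γpoly = 0 ∧
    ∀ i, eval v (pderiv i Γpoly) = 0 := by
  constructor
  · have := eval_G v
    rw [h.1, h.2] at this
    simp only [gA, gB] at this
    linear_combination (1/4352) * this
  · intro i
    rw [pd_G]
    simp [inS_Ps h, inS_Pt h, inS_Pz h]

lemma inS_ne {v : Fin 3 → ℝ} (hv : v ≠ 0) (h : InS v) : v 2 ≠ 0 := by
  intro h2
  have h1 := h.1
  rw [h2] at h1
  obtain ⟨h0, h1⟩ := sF_eq_zero (by simpa using h1)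
  apply hv; ext i; fin_cases i <;> simp [h0, h1, h2]

lemma hess_formula {v : Fin 3 → ℝ} (h : InS v) (i j : Fin 3) (hi : pderiv i f1 = 0)
    (hj : pderiv j f1 = 0) : eval v (pderiv i (pderiv j Γpoly)) =
      (eval v Pss * eval v (pderiv i f2) + eval v Pst * eval v (pderiv i f3)) * eval v (pderiv j f2)
      + (eval v Pst * eval v (pderiv i f2) - 7958/4352 * eval v (pderiv i f3))
        * eval v (pderiv j f3) := by
  rw [pd_G, hj]
  simp only [map_add, Derivation.leibniz, pd_s i hi, pd_t i hi, smul_eq_mul, map_mul, map_zero,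
    mul_zero, zero_add, map_sub, inS_Ps h, inS_Pt h, zero_mul, eval_C]
  ring

lemma hess_rank {v : Fin 3 → ℝ} (hv : v ≠ 0) (h : InS v) :
    2 ≤ Matrix.rank (Matrix.of fun i j : Fin 3 => eval v (pderiv i (pderiv j Γpoly))) := by
  set H := Matrix.of fun i j : Fin 3 => eval v (pderiv i (pderiv j Γpoly)) with hH
  have hz := inS_ne hv h
  let P : Matrix (Fin 2) (Fin 3) ℝ := !![1, 0, 0; 0, 1, 0]
  have e00 : (P * H * P.transpose) 0 0 = H 0 0 := by
    simp [P, Matrix.mul_apply, Fin.sum_univ_three, Matrix.vecMul, dotProduct]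
  have e01 : (P * H * P.transpose) 0 1 = H 0 1 := by
    simp [P, Matrix.mul_apply, Fin.sum_univ_three, Matrix.vecMul, dotProduct]
  have e10 : (P * H * P.transpose) 1 0 = H 1 0 := by
    simp [P, Matrix.mul_apply, Fin.sum_univ_three, Matrix.vecMul, dotProduct]
  have e11 : (P * H * P.transpose) 1 1 = H 1 1 := by
    simp [P, Matrix.mul_apply, Fin.sum_univ_three, Matrix.vecMul, dotProduct]
  have hdet : (P * H * P.transpose).det ≠ 0 := by
    rw [Matrix.det_fin_two, e00, e01, e10, e11]
    simp only [hH, Matrix.of_apply]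
    rw [hess_formula h 0 0 f1_0 f1_0, hess_formula h 0 1 f1_0 f1_1, hess_formula h 1 0 f1_1 f1_0,
      hess_formula h 1 1 f1_1 f1_1]
    simp only [ev_f2_0, ev_f2_1, ev_f3_0, ev_f3_1]
    have j := jac_eq v
    have im := im_sq v
    have pss := ev_Pss v
    have pst := ev_Pst v
    rw [h.1, h.2] at im pss
    rw [h.1] at pst
    simp only [gAss, gBss, gBs] at pss pst
    have e : (2 * v 0 * ty v - 2 * v 1 * tx v) ^ 2 = 144 * 486 * 200 * (v 2) ^ 12 := by
      rw [j]; linear_combination 144 * im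
    have pss' : eval v Pss = (-812335635/272) * v 2 ^ 8 := by linear_combination (1/4352) * pss
    have pst' : eval v Pst = (10465443/4352) * v 2 ^ 4 := by linear_combination (1/4352) * pst
    have : (eval v Pss * (-7958/4352) - eval v Pst ^ 2) *
      (2 * v 0 * ty v - 2 * v 1 * tx v) ^ 2 ≠ 0 := by
      rw [e, pss', pst']
      have : ((-812335635/272) * v 2 ^ 8 * (-7958/4352) - ((10465443/4352) * v 2 ^ 4) ^ 2) *
        (144 * 486 * 200 * (v 2) ^ 12) = ((-812335635/272) * (-7958/4352) - (10465443/4352) ^ 2) * (144 * 486 * 200) * v 2 ^ 20 := by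
        ring
      rw [this]
      refine mul_ne_zero (by norm_num) (pow_ne_zero _ hz)
    convert this using 1
    ring
  have h2 : (P * H * P.transpose).rank = 2 := by
    rw [Matrix.rank_of_isUnit _ ((Matrix.isUnit_iff_isUnit_det _).2 (isUnit_iff_ne_zero.2 hdet))]
    simp
  calc 2 = (P * H * P.transpose).rank := h2.symm
    _ ≤ (P * H).rank := Matrix.rank_mul_le_left _ _
    _ ≤ H.rank := Matrix.rank_mul_le_right _ _

/-! ### the orbit -/

def T : Finset (ℤ × ℤ) := {(3,1),(1,5),(-2,4),(-3,-1),(-1,-5),(2,-4),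
  (-3,1),(-2,-4),(1,-5),(3,-1),(2,4),(-1,5)}

def pt (p : ℤ × ℤ) : Fin 3 → ℝ := ![√3 * p.1, p.2, 2]

lemma pt_ne (p : ℤ × ℤ) : pt p ≠ 0 := fun h => by
  have := congrFun h 2
  simp [pt] at this

def φ (p : ℤ × ℤ) : P2R := Projectivization.mk ℝ (pt p) (pt_ne p)

lemma sq3 : √3 * √3 = (3:ℝ) := Real.mul_self_sqrt (by norm_num)

lemma φ_inj : Function.Injective φ := by
  intro p q h
  rw [φ, φ, Projectivization.mk_eq_mk_iff'] at h
  obtain ⟨a, ha⟩ := h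
  have h0 := congrFun ha 0
  have h1 := congrFun ha 1
  have h2 := congrFun ha 2
  simp [pt] at h0 h1 h2
  subst h2
  simp at h0 h1
  ext
  · exact h0.symm
  · exact h1.symm

lemma glA_mulVec (v : Fin 3 → ℝ) : (glA : Matrix (Fin 3) (Fin 3) ℝ).mulVec v =
    ![v 0 / 2 - u * v 1, u * v 0 + v 1 / 2, v 2] := by
  have : (glA : Matrix (Fin 3) (Fin 3) ℝ) = rotA := rfl
  rw [this]
  ext i
  fin_cases i <;> simp [rotA, Matrix.mulVec, dotProduct, Fin.sum_univ_three] <;> ring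

lemma glB_mulVec (v : Fin 3 → ℝ) : (glB : Matrix (Fin 3) (Fin 3) ℝ).mulVec v =
    ![- v 0, v 1, v 2] := by
  have : (glB : Matrix (Fin 3) (Fin 3) ℝ) = matB := rfl
  rw [this]
  ext i
  fin_cases i <;> simp [matB, Matrix.mulVec, dotProduct, Fin.sum_univ_three]

lemma u_sq : u ^ 2 = 3 / 4 := by
  have := sq3
  unfold u; linear_combination (1/4) * this

lemma G_inv (M : Matrix.GeneralLinearGroup (Fin 3) ℝ) (hM : M ∈ Ggrp) :
    ∀ v : Fin 3 → ℝ, InS ((M : Matrix (Fin 3) (Fin 3) ℝ).mulVec v) ↔ InS v := by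
  unfold Ggrp at hM
  induction hM using Subgroup.closure_induction with
  | mem x hx =>
    intro v
    rcases hx with rfl | rfl
    · have h := u_sq
      have e1 : sF ![v 0 / 2 - u * v 1, u * v 0 + v 1 / 2, v 2] = sF v := by
        simp [sF]
        linear_combination (v 0 ^ 2 + v 1 ^ 2) * h
      have e2 : tF ![v 0 / 2 - u * v 1, u * v 0 + v 1 / 2, v 2] = tF v := by
        have u2 := h
        have u3 : u ^ 3 = 3/4 * u := by linear_combination u * h
        have u4 : u ^ 4 = 9/16 := by linear_combination (u^2+3/4) * h
        have u5 : u ^ 5 = 9/16 * u := by linear_combination u*(u^2+3/4) * h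
        have u6 : u ^ 6 = 27/64 := by linear_combination (u^4+3/4*u^2+9/16) * h
        simp [tF]
        ring_nf
        simp only [u2, u3, u4, u5, u6]
        ring
      rw [glA_mulVec, InS, InS, e1, e2]
      simp
    · have e1 : sF ![- v 0, v 1, v 2] = sF v := by simp [sF]
      have e2 : tF ![- v 0, v 1, v 2] = tF v := by simp [tF]; ring
      rw [glB_mulVec, InS, InS, e1, e2]
      simp
  | one => simp
  | mul x y _ _ hx hy =>
    intro v
    rw [Units.val_mul, ← Matrix.mulVec_mulVec, hx, hy]
  | inv x _ hx =>
    intro v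
    rw [← hx, Matrix.mulVec_mulVec, ← Units.val_mul]
    simp

lemma inS_smul {v : Fin 3 → ℝ} {c : ℝ} (hc : c ≠ 0) : InS (c • v) ↔ InS v := by
  have e1 : sF (c • v) = c ^ 2 * sF v := by simp [sF]; ring
  have e2 : tF (c • v) = c ^ 6 * tF v := by simp [tF]; ring
  unfold InS
  rw [e1, e2]
  have : (c • v) 2 = c * v 2 := by simp
  rw [this]
  refine and_congr ?_ ?_
  · rw [← mul_right_inj' (pow_ne_zero 2 hc) (b := sF v)]
    constructor <;> intro h <;> linear_combination h
  · rw [← mul_right_inj' (pow_ne_zero 6 hc) (b := tF v)]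
    constructor <;> intro h <;> linear_combination h

lemma base_eq : (![9, 2*u, 4*u] : Fin 3 → ℝ) = √3 • pt (3, 1) := by
  have := sq3
  ext i
  fin_cases i <;> simp [pt, u] <;> nlinarith

lemma inS_base : InS (pt (3, 1)) := by
  have h := sq3
  have h2 : √3 ^ 2 = (3:ℝ) := by rw [pow_two, h]
  have h4 : √3 ^ 4 = (9:ℝ) := by rw [show √3 ^ 4 = (√3^2)^2 by ring, h2]; norm_num
  have h6 : √3 ^ 6 = (27:ℝ) := by rw [show √3 ^ 6 = (√3^2)^3 by ring, h2]; norm_num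
  constructor
  · simp [sF, pt, mul_pow, h2]; norm_num
  · simp [tF, pt, mul_pow, h2, h4, h6]; norm_num

lemma s3ne : √3 ≠ (0:ℝ) := by positivity

lemma orbit_inS {Q : P2R} (h : Q ∈ orbitOf ![9, 2*u, 4*u]) : InS Q.rep := by
  obtain ⟨M, hM, c, hc, h⟩ := h
  rw [← inS_smul hc, ← h, G_inv M hM, base_eq, inS_smul s3ne]
  exact inS_base

lemma inS_pt {v : Fin 3 → ℝ} (h : InS v) : ∃ p ∈ T, v = (v 2 / 2) • pt p := by
  obtain ⟨h1, h2⟩ := h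
  obtain ⟨k, hk⟩ : ∃ k, k = v 2 / 2 := ⟨_, rfl⟩
  have hz : v 2 = 2 * k := by rw [hk]; ring
  rw [← hk]
  have h3 := sq3
  have e1 : v 0 ^ 2 + v 1 ^ 2 = 28 * k ^ 2 := by
    rw [hz] at h1; simp only [sF] at h1; linear_combination h1
  have e2 : (v 0 ^ 2 - 27 * k ^ 2) * ((v 0 ^ 2 - 3 * k ^ 2) * (v 0 ^ 2 - 12 * k ^ 2)) = 0 := by
    have y2 : v 1 ^ 2 = 28 * k ^ 2 - v 0 ^ 2 := by linarith
    have y4 : v 1 ^ 4 = (28 * k ^ 2 - v 0 ^ 2) ^ 2 := by rw [← y2]; ring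
    have y6 : v 1 ^ 6 = (28 * k ^ 2 - v 0 ^ 2) ^ 3 := by rw [← y2]; ring
    rw [hz] at h2; simp only [tF] at h2
    rw [y2, y4, y6] at h2
    linear_combination (1/32) * h2
  have mk : ∀ (a b : ℤ), v 0 ^ 2 = 3 * a ^ 2 * k ^ 2 → (a:ℝ) ^ 2 * 3 + b ^ 2 = 28 →
      (a, b) ∈ T → (a, -b) ∈ T → (-a, b) ∈ T → (-a, -b) ∈ T → ∃ p ∈ T, v = k • pt p := by
    intro a b h0 hab t1 t2 t3 t4
    have hx : (v 0 - k * (√3 * a)) * (v 0 + k * (√3 * a)) = 0 := by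
      linear_combination h0 - k^2 * a^2 * h3
    have hy : (v 1 - k * b) * (v 1 + k * b) = 0 := by
      linear_combination e1 - h0 - k^2 * hab
    rcases mul_eq_zero.1 hx with hx | hx <;> rcases mul_eq_zero.1 hy with hy | hy
    · refine ⟨_, t1, ?_⟩
      ext i; fin_cases i <;> simp [pt] <;> linarith
    · refine ⟨_, t2, ?_⟩
      ext i; fin_cases i <;> simp [pt] <;> linarith
    · refine ⟨_, t3, ?_⟩
      ext i; fin_cases i <;> simp [pt] <;> linarith
    · refine ⟨_, t4, ?_⟩
      ext i; fin_cases i <;> simp [pt] <;> linarith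
  rcases mul_eq_zero.1 e2 with h | h
  · exact mk 3 1 (by push_cast; linarith) (by norm_num) (by decide) (by decide) (by decide) (by decide)
  rcases mul_eq_zero.1 h with h | h
  · exact mk 1 5 (by push_cast; linarith) (by norm_num) (by decide) (by decide) (by decide) (by decide)
  · exact mk 2 4 (by push_cast; linarith) (by norm_num) (by decide) (by decide) (by decide) (by decide)

def Reach (p : ℤ × ℤ) : Prop := ∃ M ∈ Ggrp,
  (M : Matrix (Fin 3) (Fin 3) ℝ).mulVec (pt (3, 1)) = pt p

lemma reachA {a b c d : ℤ} (h : Reach (a, b)) (hc : 2 * c = a - b) (hd : 2 * d = 3 * a + b) :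
    Reach (c, d) := by
  obtain ⟨M, hM, h⟩ := h
  refine ⟨glA * M, mul_mem (Subgroup.subset_closure (by simp)) hM, ?_⟩
  rw [Units.val_mul, ← Matrix.mulVec_mulVec, h, glA_mulVec]
  have h3 := sq3
  have hc' : 2 * (c:ℝ) = a - b := by exact_mod_cast hc
  have hd' : 2 * (d:ℝ) = 3 * a + b := by exact_mod_cast hd
  ext i
  fin_cases i
  · simp [pt, u]; linear_combination (-√3/2) * hc'
  · simp [pt, u]; linear_combination (-1/2) * hd' + a / 2 * h3
  · simp [pt]

lemma reachB {a b c : ℤ} (h : Reach (a, b)) (hc : c = - a) : Reach (c, b) := by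
  obtain ⟨M, hM, h⟩ := h
  refine ⟨glB * M, mul_mem (Subgroup.subset_closure (by simp)) hM, ?_⟩
  rw [Units.val_mul, ← Matrix.mulVec_mulVec, h, glB_mulVec]
  subst hc
  ext i
  fin_cases i <;> simp [pt]

lemma reach_all : ∀ p ∈ T, Reach p := by
  have r0 : Reach (3, 1) := ⟨1, one_mem _, by simp⟩
  have r1 : Reach (1, 5) := reachA r0 (by norm_num) (by norm_num)
  have r2 : Reach (-2, 4) := reachA r1 (by norm_num) (by norm_num)
  have r3 : Reach (-3, -1) := reachA r2 (by norm_num) (by norm_num)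
  have r4 : Reach (-1, -5) := reachA r3 (by norm_num) (by norm_num)
  have r5 : Reach (2, -4) := reachA r4 (by norm_num) (by norm_num)
  have q0 : Reach (-3, 1) := reachB r0 (by norm_num)
  have q1 : Reach (-2, -4) := reachA q0 (by norm_num) (by norm_num)
  have q2 : Reach (1, -5) := reachA q1 (by norm_num) (by norm_num)
  have q3 : Reach (3, -1) := reachA q2 (by norm_num) (by norm_num)
  have q4 : Reach (2, 4) := reachA q3 (by norm_num) (by norm_num)
  have q5 : Reach (-1, 5) := reachA q4 (by norm_num) (by norm_num)
  intro p hp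
  simp only [T, Finset.mem_insert, Finset.mem_singleton] at hp
  rcases hp with rfl|rfl|rfl|rfl|rfl|rfl|rfl|rfl|rfl|rfl|rfl|rfl <;> assumption

lemma mem_of_smul {Q : P2R} {p : ℤ × ℤ} (hp : p ∈ T) {k : ℝ} (hk : k ≠ 0)
    (h : Q.rep = k • pt p) : Q ∈ orbitOf ![9, 2*u, 4*u] := by
  obtain ⟨M, hM, hr⟩ := reach_all p hp
  refine ⟨M, hM, √3 / k, div_ne_zero s3ne hk, ?_⟩
  rw [base_eq, Matrix.mulVec_smul, hr, h, smul_smul, div_mul_cancel₀ _ hk]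

lemma mem_orbit_iff (Q : P2R) : Q ∈ orbitOf ![9, 2*u, 4*u] ↔ InS Q.rep := by
  refine ⟨orbit_inS, fun h => ?_⟩
  obtain ⟨p, hp, e⟩ := inS_pt h
  exact mem_of_smul hp (div_ne_zero (inS_ne Q.rep_nonzero h) two_ne_zero) e

lemma orbit_eq : orbitOf ![9, 2*u, 4*u] = φ '' (T : Set (ℤ × ℤ)) := by
  ext Q
  constructor
  · intro h
    have h := orbit_inS h
    obtain ⟨p, hp, e⟩ := inS_pt h
    refine ⟨p, hp, ?_⟩
    rw [← Q.mk_rep, φ, Projectivization.mk_eq_mk_iff']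
    have := div_ne_zero (inS_ne Q.rep_nonzero h) two_ne_zero
    refine ⟨(Q.rep 2 / 2)⁻¹, ?_⟩
    conv_lhs => rw [e]
    rw [smul_smul]
    simp only [Pi.smul_apply, smul_eq_mul]
    have h2 : pt p 2 = 2 := rfl
    have hr := inS_ne Q.rep_nonzero h
    rw [h2, show (Q.rep 2 / 2 * 2 / 2) = Q.rep 2 / 2 by ring, inv_mul_cancel₀ this, one_smul]
  · rintro ⟨p, hp, rfl⟩
    obtain ⟨a, ha⟩ := Projectivization.exists_smul_eq_mk_rep ℝ (pt p) (pt_ne p)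
    exact mem_of_smul hp a.ne_zero ha.symm

end

/-- The set of singular points of the degree-12 plane curve `{Γ = 0}` in `ℙ²(ℝ)` (points
of the curve where all first-order partial derivatives of `Γ` vanish) is exactly the
`G`-orbit of the point `(9 : 2u : 4u)`, which consists of 12 points, and each of these 12
points is an ordinary double point: the Hessian matrix of `Γ` there has rank at least 2. -/
theorem stmt15 :
    {Q : P2R | MvPolynomial.eval (Projectivization.rep Q) Γpoly = 0 ∧
        ∀ i : Fin 3,
          MvPolynomial.eval (Projectivization.rep Q) (MvPolynomial.pderiv i Γpoly) = 0}
      = orbitOf ![9, 2*u, 4*u] ∧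
    (orbitOf ![9, 2*u, 4*u]).ncard = 12 ∧
    ∀ Q ∈ orbitOf ![9, 2*u, 4*u],
      2 ≤ Matrix.rank (Matrix.of fun i j : Fin 3 =>
        MvPolynomial.eval (Projectivization.rep Q)
          (MvPolynomial.pderiv i (MvPolynomial.pderiv j Γpoly))) := by
  refine ⟨?_, ?_, ?_⟩
  · ext Q
    rw [mem_orbit_iff]
    exact ⟨fun h => sing_imp _ Q.rep_nonzero h.1 h.2, fun h => inS_sing h⟩
  · rw [orbit_eq, Set.ncard_image_of_injective _ φ_inj, Set.ncard_coe_finset]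
    rfl
  · intro Q hQ
    exact hess_rank Q.rep_nonzero ((mem_orbit_iff Q).1 hQ)
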